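/- arXiv:2404.11902 — 3 statements merged into one kernel-verified Lean document; each statement's English description precedes it below -/
import Mathlib

section
/- Let ρ be a nontrivial zero of the Riemann zeta function with Re(ρ) < 1/2. Then there exists a constant C > 0 such that for every positive integer l, ∫₀^∞ |∫_{1/2}^∞ g_ρ(x·t)·sin((2l+1)πt)/(πt) dt|² dx ≤ C/(2l+1)⁴. -/
open MeasureTheory Real Filter

/-- The function `η(x) = 8πx²(πx² − 3/2)e^{−πx²}`. -/
noncomputable def eta (x : ℝ) : ℝ :=
  8 * π * x ^ 2 * (π * x ^ 2 - 3 / 2) * Real.exp (-π * x ^ 2)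

/-- `g ρ = Z⁻¹ F_ρ`, given by `g ρ t = ∫₁^∞ η(u·t)·u^{ρ−1} du`. -/
noncomputable def g (ρ : ℂ) (t : ℝ) : ℂ :=
  ∫ u in Set.Ioi (1 : ℝ), (eta (u * t) : ℂ) * (u : ℂ) ^ (ρ - 1)

/-- `F_ρ x = ∫₁^∞ (Σ_{n≥1} η(n·t·x))·t^{ρ−1} dt`. -/
noncomputable def F (ρ : ℂ) (x : ℝ) : ℂ :=
  ∫ t in Set.Ioi (1 : ℝ), (∑' n : ℕ, (eta (((n : ℝ) + 1) * t * x) : ℂ)) * (t : ℂ) ^ (ρ - 1)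

/-- `δ_{l,ρ}(x) = ∫₀^∞ g ρ (x·t)·sin((2l+1)πt)/(πt) dt`. -/
noncomputable def delta (l : ℕ) (ρ : ℂ) (x : ℝ) : ℂ :=
  ∫ t in Set.Ioi (0 : ℝ),
    g ρ (x * t) * ((Real.sin ((2 * (l : ℝ) + 1) * π * t) / (π * t) : ℝ) : ℂ)

/-- The Fourier transform `𝔉f(y) = ∫_ℝ f(x)·e^{2πixy} dx`. -/
noncomputable def FT (f : ℝ → ℂ) (y : ℝ) : ℂ :=
  ∫ x : ℝ, f x * Complex.exp (((2 * π * x * y : ℝ) : ℂ) * Complex.I)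

open scoped ENNReal NNReal

/-- The derivative of `eta`. -/
noncomputable def etaDeriv (x : ℝ) : ℝ :=
  (56 * π ^ 2 * x ^ 3 - 24 * π * x - 16 * π ^ 3 * x ^ 5) * Real.exp (-π * x ^ 2)

lemma hasDerivAt_eta (x : ℝ) : HasDerivAt eta (etaDeriv x) x := by
  have hsq : HasDerivAt (fun y : ℝ => y ^ 2) (2 * x) x := by simpa using hasDerivAt_pow 2 x
  have h := ((hsq.const_mul (8 * π)).mul ((hsq.const_mul π).sub_const (3 / 2))).mul
    (hsq.const_mul (-π)).exp
  refine h.congr_deriv ?_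
  simp only [etaDeriv, Pi.mul_apply]
  ring

lemma continuous_eta : Continuous eta := by unfold eta; fun_prop

lemma continuous_etaDeriv : Continuous etaDeriv := by unfold etaDeriv; fun_prop

lemma pow_mul_exp_neg_pi_mul_sq_le (k : ℕ) {v : ℝ} (hv : 0 ≤ v) :
    v ^ k * Real.exp (-π * v ^ 2) ≤ k.factorial * Real.exp 1 * Real.exp (-2 * v) := by
  have h1 : v ^ k ≤ k.factorial * Real.exp v := by
    have := Real.pow_div_factorial_le_exp v hv k
    rwa [div_le_iff₀ (by positivity), mul_comm] at this
  have h2 : Real.exp (-π * v ^ 2) ≤ Real.exp (1 - 3 * v) := by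
    apply Real.exp_le_exp.2
    nlinarith [Real.pi_gt_three, sq_nonneg (v - 1 / 2), sq_nonneg v]
  calc v ^ k * Real.exp (-π * v ^ 2)
      ≤ (k.factorial * Real.exp v) * Real.exp (1 - 3 * v) := by gcongr
    _ = k.factorial * Real.exp 1 * Real.exp (-2 * v) := by
      rw [mul_assoc, mul_assoc, ← Real.exp_add, ← Real.exp_add]
      ring_nf

lemma exists_eta_le : ∃ K > 0, ∀ v : ℝ, 0 ≤ v →
    |eta v| ≤ K * Real.exp (-2 * v) ∧ |v * etaDeriv v| ≤ K * Real.exp (-2 * v) := by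
  refine ⟨(56 * π ^ 2 * Nat.factorial 4 + 24 * π * Nat.factorial 2 +
    16 * π ^ 3 * Nat.factorial 6) * Real.exp 1, by positivity, fun v hv => ?_⟩
  have h2 := pow_mul_exp_neg_pi_mul_sq_le 2 hv
  have h4 := pow_mul_exp_neg_pi_mul_sq_le 4 hv
  have h6 := pow_mul_exp_neg_pi_mul_sq_le 6 hv
  have key : ∀ a b c : ℝ, |a| ≤ 56 * π ^ 2 → |b| ≤ 24 * π → |c| ≤ 16 * π ^ 3 →
      |(a * v ^ 4 + b * v ^ 2 + c * v ^ 6) * Real.exp (-π * v ^ 2)| ≤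
        (56 * π ^ 2 * Nat.factorial 4 + 24 * π * Nat.factorial 2 +
          16 * π ^ 3 * Nat.factorial 6) * Real.exp 1 * Real.exp (-2 * v) := by
    intro a b c ha hb hc
    have habs : |v| = v := abs_of_nonneg hv
    calc _ = |a * (v ^ 4 * Real.exp (-π * v ^ 2)) + b * (v ^ 2 * Real.exp (-π * v ^ 2)) +
          c * (v ^ 6 * Real.exp (-π * v ^ 2))| := by ring_nf
      _ ≤ |a| * (v ^ 4 * Real.exp (-π * v ^ 2)) + |b| * (v ^ 2 * Real.exp (-π * v ^ 2)) +
          |c| * (v ^ 6 * Real.exp (-π * v ^ 2)) := by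
        refine (abs_add_three _ _ _).trans_eq ?_
        simp only [abs_mul, abs_pow, Real.abs_exp, habs]
      _ ≤ 56 * π ^ 2 * (Nat.factorial 4 * Real.exp 1 * Real.exp (-2 * v)) +
          24 * π * (Nat.factorial 2 * Real.exp 1 * Real.exp (-2 * v)) +
          16 * π ^ 3 * (Nat.factorial 6 * Real.exp 1 * Real.exp (-2 * v)) := by gcongr
      _ = _ := by ring
  have hpi := Real.pi_pos
  constructor
  · convert key (8 * π ^ 2) (-12 * π) 0 ?_ ?_ ?_ using 2
    · unfold eta; ring
    · rw [abs_of_nonneg (by positivity)]; nlinarith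
    · rw [abs_mul, abs_of_pos hpi]; norm_num; linarith
    · simp; positivity
  · convert key (56 * π ^ 2) (-24 * π) (-16 * π ^ 3) ?_ ?_ ?_ using 2
    · unfold etaDeriv; ring
    · rw [abs_of_nonneg (by positivity)]
    · rw [abs_mul, abs_of_pos hpi]; norm_num
    · rw [abs_mul, abs_of_pos (by positivity : 0 < π ^ 3)]; norm_num

lemma integrableOn_eta_mul_cpow {ρ : ℂ} (hρ : 0 < ρ.re) :
    IntegrableOn (fun v : ℝ => (eta v : ℂ) * (v : ℂ) ^ (ρ - 1)) (Set.Ioi 0) := by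
  obtain ⟨K, hK, hη⟩ := exists_eta_le
  refine Integrable.mono' ((Real.GammaIntegral_convergent hρ).const_mul K) ?_ ?_
  · refine ContinuousOn.aestronglyMeasurable (fun v hv => ?_) measurableSet_Ioi
    refine ContinuousAt.continuousWithinAt (ContinuousAt.mul ?_ ?_)
    · exact (Complex.continuous_ofReal.comp continuous_eta).continuousAt
    · exact Complex.continuousAt_ofReal_cpow_const _ _ (Or.inr (ne_of_gt hv))
  · refine ae_restrict_of_forall_mem measurableSet_Ioi fun v hv => ?_
    have hv' : (0 : ℝ) < v := hv
    rw [norm_mul, Complex.norm_cpow_eq_rpow_re_of_pos hv', Complex.norm_real, Real.norm_eq_abs,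
      ← mul_assoc]
    simp only [Complex.sub_re, Complex.one_re]
    gcongr
    refine (hη v hv'.le).1.trans ?_
    gcongr
    linarith

lemma g_eq {ρ : ℂ} {t : ℝ} (ht : 0 < t) :
    g ρ t = (t : ℂ) ^ (-ρ) * ∫ v in Set.Ioi t, (eta v : ℂ) * (v : ℂ) ^ (ρ - 1) := by
  have h := integral_comp_mul_right_Ioi (fun v : ℝ => (eta v : ℂ) * (v : ℂ) ^ (ρ - 1)) 1 ht
  have ht0 : (t : ℂ) ≠ 0 := by exact_mod_cast ht.ne'
  rw [one_mul] at h
  have h2 : (∫ v in Set.Ioi t, (eta v : ℂ) * (v : ℂ) ^ (ρ - 1)) =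
      t * ∫ u in Set.Ioi (1 : ℝ), (eta (u * t) : ℂ) * ((u * t : ℝ) : ℂ) ^ (ρ - 1) := by
    rw [h, Complex.real_smul, Complex.ofReal_inv, mul_inv_cancel_left₀ ht0]
  rw [h2, ← integral_const_mul, ← integral_const_mul, g]
  refine setIntegral_congr_fun measurableSet_Ioi fun u hu => ?_
  have hu' : (0 : ℝ) ≤ u := zero_le_one.trans (le_of_lt hu)
  have : (t : ℂ) ^ (-ρ) * (t * (t : ℂ) ^ (ρ - 1)) = 1 := by
    rw [Complex.cpow_sub _ _ ht0, Complex.cpow_neg, Complex.cpow_one]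
    have : (t : ℂ) ^ ρ ≠ 0 := by simp [Complex.cpow_eq_zero_iff, ht0]
    field_simp
  simp only [Complex.ofReal_mul, Complex.mul_cpow_ofReal_nonneg hu' ht.le]
  linear_combination -(eta (u * t) : ℂ) * (u : ℂ) ^ (ρ - 1) * this

lemma hasDerivAt_g {ρ : ℂ} (hρ : 0 < ρ.re) {t : ℝ} (ht : 0 < t) :
    HasDerivAt (g ρ) (-(ρ * g ρ t + eta t) / t) t := by
  have hint := integrableOn_eta_mul_cpow hρ
  set f : ℝ → ℂ := fun v => (eta v : ℂ) * (v : ℂ) ^ (ρ - 1) with hf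
  have ht0 : (t : ℂ) ≠ 0 := by exact_mod_cast ht.ne'
  have hρ0 : ρ ≠ 0 := by rintro rfl; simp at hρ
  have hsplit : ∀ s : ℝ, 0 < s →
      ∫ v in Set.Ioi s, f v = (∫ v in Set.Ioi 0, f v) - ∫ v in (0 : ℝ)..s, f v := by
    intro s hs
    rw [← intervalIntegral.integral_interval_add_Ioi (b := s) hint
      (hint.mono_set (Set.Ioi_subset_Ioi hs.le))]
    ring
  have hcont : ContinuousAt f t := by
    refine ContinuousAt.mul (Complex.continuous_ofReal.comp continuous_eta).continuousAt ?_
    exact Complex.continuousAt_ofReal_cpow_const _ _ (Or.inr ht.ne')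
  have hd : HasDerivAt (fun s : ℝ => ∫ v in Set.Ioi s, f v) (-f t) t := by
    have h1 : HasDerivAt (fun s : ℝ => ∫ v in (0 : ℝ)..s, f v) (f t) t := by
      refine intervalIntegral.integral_hasDerivAt_right ?_ ?_ hcont
      · rw [intervalIntegrable_iff_integrableOn_Ioc_of_le ht.le]
        exact hint.mono_set Set.Ioc_subset_Ioi_self
      · exact ⟨Set.Ioi 0, Ioi_mem_nhds ht, hint.aestronglyMeasurable⟩
    refine (h1.const_sub (∫ v in Set.Ioi 0, f v)).congr_of_eventuallyEq ?_
    filter_upwards [Ioi_mem_nhds ht] with s hs using hsplit s hs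
  have hp := hasDerivAt_ofReal_cpow_const ht.ne' (neg_ne_zero.2 hρ0)
  refine ((hp.mul hd).congr_of_eventuallyEq ?_).congr_deriv ?_
  · filter_upwards [Ioi_mem_nhds ht] with s hs using g_eq hs
  · simp only [g_eq ht, hf, Complex.cpow_sub _ _ ht0, Complex.cpow_neg, Complex.cpow_one]
    have : (t : ℂ) ^ ρ ≠ 0 := by simp [Complex.cpow_eq_zero_iff, ht0]
    field_simp
    ring

lemma exp_neg_two_mul_le {σ v : ℝ} (h0 : 0 ≤ σ) (h1 : σ ≤ 1) (hv : 0 < v) :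
    Real.exp (-2 * v) ≤ Real.exp (-v) * v ^ (-σ) := by
  have h : v ^ σ ≤ Real.exp v := by
    rw [Real.rpow_def_of_pos hv, Real.exp_le_exp]
    have := Real.log_le_sub_one_of_pos hv
    nlinarith
  rw [show -2 * v = -v + -v by ring, Real.exp_add, Real.rpow_neg hv.le, Real.exp_neg v]
  gcongr

lemma exists_g_le {ρ : ℂ} (hρ : 0 < ρ.re) :
    ∃ K > 0, ∀ v : ℝ, 0 < v → ‖g ρ v‖ ≤ K * (Real.exp (-v) * v ^ (-ρ.re)) := by
  obtain ⟨K, hK, hη⟩ := exists_eta_le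
  refine ⟨K * Real.Gamma ρ.re, mul_pos hK (Real.Gamma_pos_of_pos hρ), fun t ht => ?_⟩
  have hG := Real.GammaIntegral_convergent hρ
  have hbound : ‖∫ v in Set.Ioi t, (eta v : ℂ) * (v : ℂ) ^ (ρ - 1)‖ ≤
      ∫ v in Set.Ioi t, K * Real.exp (-t) * (Real.exp (-v) * v ^ (ρ.re - 1)) := by
    refine norm_integral_le_of_norm_le
      ((hG.mono_set (Set.Ioi_subset_Ioi ht.le)).const_mul _) ?_
    refine ae_restrict_of_forall_mem measurableSet_Ioi fun v hv => ?_
    have hv' : t < v := hv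
    have hv0 : 0 < v := ht.trans hv'
    rw [norm_mul, Complex.norm_cpow_eq_rpow_re_of_pos hv0, Complex.norm_real, Real.norm_eq_abs,
      ← mul_assoc]
    simp only [Complex.sub_re, Complex.one_re]
    gcongr
    refine (hη v hv0.le).1.trans ?_
    rw [mul_assoc, ← Real.exp_add]
    gcongr
    linarith
  have hmono : ∫ v in Set.Ioi t, Real.exp (-v) * v ^ (ρ.re - 1) ≤ Real.Gamma ρ.re := by
    rw [Real.Gamma_eq_integral hρ]
    refine setIntegral_mono_set hG ?_ (Set.Ioi_subset_Ioi ht.le).eventuallyLE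
    exact ae_restrict_of_forall_mem measurableSet_Ioi fun v hv =>
      mul_nonneg (Real.exp_pos _).le (Real.rpow_nonneg (le_of_lt hv) _)
  rw [g_eq ht, norm_mul, Complex.norm_cpow_eq_rpow_re_of_pos ht, Complex.neg_re]
  rw [integral_const_mul] at hbound
  calc _ ≤ t ^ (-ρ.re) * (K * Real.exp (-t) * Real.Gamma ρ.re) := by
        gcongr
        exact hbound.trans (by gcongr)
    _ = _ := by ring

/-- Two integrations by parts against a sine whose first boundary term vanishes. -/
lemma norm_integral_mul_sin_le {φ φ₁ φ₂ : ℝ → ℂ} {a ω : ℝ} (hω : ω ≠ 0)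
    (hφ : ∀ t ∈ Set.Ici a, HasDerivAt φ (φ₁ t) t)
    (hφ₁ : ∀ t ∈ Set.Ici a, HasDerivAt φ₁ (φ₂ t) t)
    (hint : IntegrableOn φ (Set.Ioi a)) (hint₂ : IntegrableOn φ₂ (Set.Ioi a))
    (hlim : Tendsto φ atTop (nhds 0)) (hlim₁ : Tendsto φ₁ atTop (nhds 0))
    (hcos : Real.cos (ω * a) = 0) :
    ‖∫ t in Set.Ioi a, φ t * (Real.sin (ω * t) : ℂ)‖ ≤
      (‖φ₁ a‖ + ∫ t in Set.Ioi a, ‖φ₂ t‖) / ω ^ 2 := by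
  have hω' : (ω : ℂ) ≠ 0 := by exact_mod_cast hω
  have hsin_meas : AEStronglyMeasurable (fun t : ℝ => (Real.sin (ω * t) : ℂ))
      (volume.restrict (Set.Ioi a)) := by
    apply Continuous.aestronglyMeasurable; fun_prop
  have hsin_le : ∀ t : ℝ, ‖(Real.sin (ω * t) : ℂ)‖ ≤ 1 := fun t => by
    rw [Complex.norm_real]; exact Real.abs_sin_le_one _
  have hcos_le : ∀ t : ℝ, ‖(Real.cos (ω * t) : ℂ)‖ ≤ 1 := fun t => by
    rw [Complex.norm_real]; exact Real.abs_cos_le_one _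
  have hi : IntegrableOn (fun t => φ t * (Real.sin (ω * t) : ℂ)) (Set.Ioi a) :=
    Integrable.mul_bdd (c := 1) hint hsin_meas (Eventually.of_forall hsin_le)
  have hi₂ : IntegrableOn (fun t => φ₂ t * (Real.sin (ω * t) : ℂ)) (Set.Ioi a) :=
    Integrable.mul_bdd (c := 1) hint₂ hsin_meas (Eventually.of_forall hsin_le)
  have hderiv : ∀ t ∈ Set.Ici a, HasDerivAt
      (fun t => φ₁ t * (Real.sin (ω * t) : ℂ) * ((ω : ℂ) ^ 2)⁻¹ -
        φ t * (Real.cos (ω * t) : ℂ) * (ω : ℂ)⁻¹)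
      (φ t * (Real.sin (ω * t) : ℂ) + φ₂ t * (Real.sin (ω * t) : ℂ) * ((ω : ℂ) ^ 2)⁻¹) t := by
    intro t ht
    have hl : HasDerivAt (fun t : ℝ => ω * t) ω t := by
      simpa using (hasDerivAt_id t).const_mul ω
    have hs := hl.sin.ofReal_comp
    have hc := hl.cos.ofReal_comp
    refine ((((hφ₁ t ht).mul hs).mul_const ((ω : ℂ) ^ 2)⁻¹).sub
      (((hφ t ht).mul hc).mul_const (ω : ℂ)⁻¹)).congr_deriv ?_
    push_cast
    field_simp
    ring
  have hzero : ∀ {ψ : ℝ → ℂ} {c : ℝ → ℂ}, Tendsto ψ atTop (nhds 0) → (∀ t, ‖c t‖ ≤ 1) →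
      Tendsto (fun t => ψ t * c t) atTop (nhds 0) := fun hψ hc =>
    squeeze_zero_norm (fun t => (norm_mul _ _).trans_le
      (mul_le_of_le_one_right (norm_nonneg _) (hc t))) (by simpa using hψ.norm)
  have hlimit := ((hzero hlim₁ hsin_le).mul_const ((ω : ℂ) ^ 2)⁻¹).sub
    ((hzero hlim hcos_le).mul_const (ω : ℂ)⁻¹)
  have hmain := integral_Ioi_of_hasDerivAt_of_tendsto' hderiv
    (hi.add (hi₂.mul_const _)) hlimit
  rw [integral_add hi (hi₂.mul_const _), integral_mul_const, hcos] at hmain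
  have heq : ∫ t in Set.Ioi a, φ t * (Real.sin (ω * t) : ℂ) =
      -(φ₁ a * (Real.sin (ω * a) : ℂ) + ∫ t in Set.Ioi a, φ₂ t * (Real.sin (ω * t) : ℂ)) /
        (ω : ℂ) ^ 2 := by
    rw [eq_sub_of_add_eq hmain]
    simp only [zero_mul, sub_self, Complex.ofReal_zero, mul_zero, sub_zero]
    ring
  rw [heq, norm_div, norm_neg, norm_pow, Complex.norm_real, Real.norm_eq_abs, sq_abs]
  gcongr
  refine (norm_add_le _ _).trans (add_le_add ?_ ?_)
  · rw [norm_mul]; exact mul_le_of_le_one_right (norm_nonneg _) (hsin_le a)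
  · refine norm_integral_le_of_norm_le hint₂.norm (Eventually.of_forall fun t => ?_)
    rw [norm_mul]; exact mul_le_of_le_one_right (norm_nonneg _) (hsin_le t)

/-- The functions of `t` produced by differentiating `g ρ (x * t) / (π * t)`. -/
noncomputable def gEtaQuotient (ρ : ℂ) (x : ℝ) (n : ℕ) (a b c : ℂ) (t : ℝ) : ℂ :=
  (a * g ρ (x * t) + b * eta (x * t) + c * (x * t * etaDeriv (x * t) : ℝ)) / (π * t ^ n)

lemma hasDerivAt_gEtaQuotient {ρ : ℂ} (hρ : 0 < ρ.re) {x t : ℝ} (hx : 0 < x) (ht : 0 < t)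
    (n : ℕ) (a b : ℂ) :
    HasDerivAt (gEtaQuotient ρ x n a b 0)
      (gEtaQuotient ρ x (n + 1) (-(ρ + n) * a) (-(a + n * b)) b t) t := by
  have ht0 : (t : ℂ) ≠ 0 := by exact_mod_cast ht.ne'
  have hx0 : (x : ℂ) ≠ 0 := by exact_mod_cast hx.ne'
  have hπ : (π : ℂ) ≠ 0 := by exact_mod_cast Real.pi_ne_zero
  have hl : HasDerivAt (fun t : ℝ => x * t) x t := by simpa using (hasDerivAt_id t).const_mul x
  have hg := (hasDerivAt_g hρ (mul_pos hx ht)).scomp t hl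
  have he := ((hasDerivAt_eta (x * t)).comp t hl).ofReal_comp
  have hp := ((hasDerivAt_pow n t).ofReal_comp).const_mul (π : ℂ)
  have h := ((hg.const_mul a).add (he.const_mul b)).div hp
    (mul_ne_zero hπ (by exact_mod_cast (pow_pos ht n).ne'))
  refine (h.congr_of_eventuallyEq (Eventually.of_forall fun s => ?_)).congr_deriv ?_
  · simp [gEtaQuotient]
  · rcases n with _ | n <;>
    · simp [gEtaQuotient]
      field_simp
      ring

lemma continuousOn_gEtaQuotient {ρ : ℂ} (hρ : 0 < ρ.re) {x : ℝ} (hx : 0 < x) (n : ℕ)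
    (a b c : ℂ) : ContinuousOn (gEtaQuotient ρ x n a b c) (Set.Ioi 0) := by
  intro t ht
  have ht' : 0 < t := ht
  have hg : ContinuousAt (fun t : ℝ => g ρ (x * t)) t :=
    ContinuousAt.comp (g := g ρ) (hasDerivAt_g hρ (mul_pos hx ht')).continuousAt
      (by fun_prop)
  have he : Continuous (fun t : ℝ => (eta (x * t) : ℂ)) :=
    Complex.continuous_ofReal.comp (continuous_eta.comp (by fun_prop))
  have hd : Continuous (fun t : ℝ => ((x * t * etaDeriv (x * t) : ℝ) : ℂ)) :=
    Complex.continuous_ofReal.comp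
      ((by fun_prop : Continuous fun t : ℝ => x * t).mul (continuous_etaDeriv.comp (by fun_prop)))
  refine ContinuousAt.continuousWithinAt (ContinuousAt.div ?_ (by fun_prop) ?_)
  · exact ((continuousAt_const.mul hg).add (continuousAt_const.mul he.continuousAt)).add
      (continuousAt_const.mul hd.continuousAt)
  · exact mul_ne_zero (by exact_mod_cast Real.pi_ne_zero) (by exact_mod_cast (pow_pos ht' n).ne')

lemma exists_gEtaQuotient_le {ρ : ℂ} (h0 : 0 < ρ.re) (h1 : ρ.re ≤ 1) :
    ∃ K > 0, ∀ (x : ℝ) (n : ℕ) (a b c : ℂ) (t : ℝ), 0 < x → 1 / 2 ≤ t →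
      ‖gEtaQuotient ρ x n a b c t‖ ≤
        K * (‖a‖ + ‖b‖ + ‖c‖) * (x / 2) ^ (-ρ.re) * Real.exp (-x * t) / t ^ n := by
  obtain ⟨K₁, hK₁, hη⟩ := exists_eta_le
  obtain ⟨K₂, hK₂, hg⟩ := exists_g_le h0
  refine ⟨max K₁ K₂, lt_max_of_lt_left hK₁, fun x n a b c t hx ht => ?_⟩
  have ht0 : 0 < t := by linarith
  have hxt : 0 < x * t := mul_pos hx ht0
  set K := max K₁ K₂
  set h := (x / 2) ^ (-ρ.re) * Real.exp (-x * t) with hh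
  have hle : Real.exp (-(x * t)) * (x * t) ^ (-ρ.re) ≤ h := by
    rw [hh, mul_comm, neg_mul]
    gcongr ?_ * _
    exact Real.rpow_le_rpow_of_nonpos (by positivity) (by nlinarith) (by linarith)
  have hexp : Real.exp (-2 * (x * t)) ≤ h := (exp_neg_two_mul_le h0.le h1 hxt).trans hle
  have bg : ‖g ρ (x * t)‖ ≤ K * h :=
    (hg _ hxt).trans (mul_le_mul (le_max_right _ _) hle (by positivity) (by positivity))
  have be : ‖(eta (x * t) : ℂ)‖ ≤ K * h := by
    rw [Complex.norm_real]
    exact (hη _ hxt.le).1.trans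
      (mul_le_mul (le_max_left _ _) hexp (by positivity) (by positivity))
  have bd : ‖((x * t * etaDeriv (x * t) : ℝ) : ℂ)‖ ≤ K * h := by
    rw [Complex.norm_real]
    exact (hη _ hxt.le).2.trans
      (mul_le_mul (le_max_left _ _) hexp (by positivity) (by positivity))
  have hden : ‖(π : ℂ) * (t : ℂ) ^ n‖ = π * t ^ n := by
    rw [norm_mul, norm_pow, Complex.norm_real, Complex.norm_real,
      Real.norm_of_nonneg Real.pi_pos.le, Real.norm_of_nonneg ht0.le]
  rw [gEtaQuotient, norm_div, hden]
  have hnum : ‖a * g ρ (x * t) + b * eta (x * t) + c * (x * t * etaDeriv (x * t) : ℝ)‖ ≤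
      K * (‖a‖ + ‖b‖ + ‖c‖) * (x / 2) ^ (-ρ.re) * Real.exp (-x * t) := by
    calc _ ≤ ‖a‖ * (K * h) + ‖b‖ * (K * h) + ‖c‖ * (K * h) := by
          refine norm_add₃_le.trans ?_
          simp only [norm_mul a, norm_mul b, norm_mul c]
          gcongr
      _ = _ := by rw [hh]; ring
  refine div_le_div₀ (by positivity) hnum (by positivity) ?_
  have := Real.pi_gt_three
  exact le_mul_of_one_le_left (by positivity) (by linarith)

lemma exists_norm_integral_g_mul_sin_le {ρ : ℂ} (h0 : 0 < ρ.re) (h1 : ρ.re ≤ 1) :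
    ∃ C > 0, ∀ ω x : ℝ, ω ≠ 0 → Real.cos (ω * (1 / 2)) = 0 → 0 < x →
      ‖∫ t in Set.Ioi (1 / 2 : ℝ), g ρ (x * t) * ((Real.sin (ω * t) / (π * t) : ℝ) : ℂ)‖ ≤
        C * (x / 2) ^ (-ρ.re) * Real.exp (-x * (1 / 2)) / ω ^ 2 := by
  obtain ⟨K, hK, hq⟩ := exists_gEtaQuotient_le h0 h1
  set A : ℂ := -(ρ + (1 : ℕ)) * 1
  set B : ℂ := -(1 + (1 : ℕ) * 0)
  set A' : ℂ := -(ρ + (2 : ℕ)) * A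
  set B' : ℂ := -(A + (2 : ℕ) * B)
  set J : ℝ := ∫ t in Set.Ioi (1 / 2 : ℝ), t ^ (-3 : ℝ)
  have hJ : 0 ≤ J := setIntegral_nonneg measurableSet_Ioi fun t ht =>
    Real.rpow_nonneg (by linarith [Set.mem_Ioi.1 ht]) _
  refine ⟨K * (‖A‖ + ‖B‖ + ‖(0 : ℂ)‖) * 4 + K * (‖A'‖ + ‖B'‖ + ‖B‖) * J + 1, by positivity,
    fun ω x hω hcos hx => ?_⟩
  have hexp : ∀ (n : ℕ) (a b c : ℂ) (t : ℝ), 1 / 2 ≤ t → ‖gEtaQuotient ρ x n a b c t‖ ≤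
      K * (‖a‖ + ‖b‖ + ‖c‖) * (x / 2) ^ (-ρ.re) * 2 ^ n * Real.exp (-x * t) := by
    intro n a b c t ht
    have ht0 : 0 < t := by linarith
    refine (hq x n a b c t hx ht).trans ?_
    rw [div_le_iff₀ (by positivity), mul_assoc _ (2 ^ n), mul_assoc _ (2 ^ n * _)]
    have : 1 ≤ (2 : ℝ) ^ n * t ^ n := by
      rw [← mul_pow]; exact one_le_pow₀ (by linarith)
    rw [show (2 : ℝ) ^ n * Real.exp (-x * t) * t ^ n = Real.exp (-x * t) * (2 ^ n * t ^ n) by ring]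
    gcongr
    exact le_mul_of_one_le_right (by positivity) this
  have hint : ∀ (n : ℕ) (a b c : ℂ),
      IntegrableOn (gEtaQuotient ρ x n a b c) (Set.Ioi (1 / 2)) := by
    intro n a b c
    refine Integrable.mono' ((exp_neg_integrableOn_Ioi (1 / 2) hx).const_mul _)
      (ContinuousOn.aestronglyMeasurable ((continuousOn_gEtaQuotient h0 hx n a b c).mono
        (Set.Ioi_subset_Ioi (by norm_num))) measurableSet_Ioi)
      (ae_restrict_of_forall_mem measurableSet_Ioi fun t ht => hexp n a b c t (le_of_lt ht))
  have hlim : ∀ (n : ℕ) (a b c : ℂ), Tendsto (gEtaQuotient ρ x n a b c) atTop (nhds 0) := by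
    intro n a b c
    refine squeeze_zero_norm' ((eventually_ge_atTop (1 / 2)).mono (hexp n a b c)) ?_
    have : Tendsto (fun t : ℝ => Real.exp (-x * t)) atTop (nhds 0) :=
      Real.tendsto_exp_atBot.comp (tendsto_id.const_mul_atTop_of_neg (by linarith))
    simpa using this.const_mul _
  have hmain := norm_integral_mul_sin_le (φ := gEtaQuotient ρ x 1 1 0 0)
    (φ₁ := gEtaQuotient ρ x 2 A B 0) (φ₂ := gEtaQuotient ρ x 3 A' B' B) hω
    (fun t ht => hasDerivAt_gEtaQuotient h0 hx (by linarith [Set.mem_Ici.1 ht]) 1 1 0)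
    (fun t ht => hasDerivAt_gEtaQuotient h0 hx (by linarith [Set.mem_Ici.1 ht]) 2 A B)
    (hint _ _ _ _) (hint _ _ _ _) (hlim _ _ _ _) (hlim _ _ _ _) hcos
  have hcongr : ∫ t in Set.Ioi (1 / 2 : ℝ), g ρ (x * t) * ((Real.sin (ω * t) / (π * t) : ℝ) : ℂ) =
      ∫ t in Set.Ioi (1 / 2 : ℝ), gEtaQuotient ρ x 1 1 0 0 t * (Real.sin (ω * t) : ℂ) := by
    congr 1
    ext t
    simp only [gEtaQuotient]
    push_cast
    ring
  rw [hcongr]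
  refine hmain.trans ?_
  gcongr
  set H := (x / 2) ^ (-ρ.re) * Real.exp (-x * (1 / 2)) with hH
  have hboundary : ‖gEtaQuotient ρ x 2 A B 0 (1 / 2)‖ ≤ K * (‖A‖ + ‖B‖ + ‖(0 : ℂ)‖) * 4 * H := by
    refine (hexp 2 A B 0 (1 / 2) le_rfl).trans_eq ?_
    rw [hH]; ring
  have hrest : ∫ t in Set.Ioi (1 / 2 : ℝ), ‖gEtaQuotient ρ x 3 A' B' B t‖ ≤
      K * (‖A'‖ + ‖B'‖ + ‖B‖) * H * J := by
    rw [← integral_const_mul]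
    refine setIntegral_mono_on (hint _ _ _ _).norm
      ((integrableOn_Ioi_rpow_of_lt (by norm_num) (by norm_num)).const_mul _)
      measurableSet_Ioi fun t ht => ?_
    have ht' : 1 / 2 < t := ht
    have ht0 : 0 < t := by linarith
    have hmono : Real.exp (-x * t) ≤ Real.exp (-x * (1 / 2)) := Real.exp_le_exp.2 (by nlinarith)
    refine (hq x 3 A' B' B t hx ht'.le).trans ?_
    rw [Real.rpow_neg ht0.le, show (3 : ℝ) = (3 : ℕ) by norm_num, Real.rpow_natCast,
      ← div_eq_mul_inv, hH, ← mul_assoc]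
    gcongr
  calc _ ≤ K * (‖A‖ + ‖B‖ + ‖(0 : ℂ)‖) * 4 * H + K * (‖A'‖ + ‖B'‖ + ‖B‖) * H * J + H := by
        have : 0 ≤ H := by positivity
        linarith
    _ = _ := by rw [hH]; ring

theorem stmt_12 (ρ : ℂ) (hζ : riemannZeta ρ = 0) (hρ0 : 0 < ρ.re) (hρ1 : ρ.re < 1 / 2) :
    ∃ C > (0 : ℝ), ∀ l : ℕ, 0 < l →
      (∫⁻ x in Set.Ioi (0 : ℝ),
          (‖∫ t in Set.Ioi (1 / 2 : ℝ),
              g ρ (x * t) *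
                ((Real.sin ((2 * (l : ℝ) + 1) * π * t) / (π * t) : ℝ) : ℂ)‖₊ : ℝ≥0∞) ^ 2)
        ≤ ENNReal.ofReal (C / (2 * l + 1) ^ 4) := by
  obtain ⟨C, hC, hbound⟩ := exists_norm_integral_g_mul_sin_le hρ0 (by linarith)
  set f : ℝ → ℝ := fun x => (x / 2) ^ (-2 * ρ.re) * Real.exp (-x) with hf
  have hfint : IntegrableOn f (Set.Ioi 0) := by
    have h := (integrableOn_rpow_mul_exp_neg_mul_rpow (s := -2 * ρ.re) (p := 1) (b := 1)
      (by linarith) one_pos one_pos).const_mul ((1 / 2 : ℝ) ^ (-2 * ρ.re))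
    refine IntegrableOn.congr_fun h (fun x hx => ?_) measurableSet_Ioi
    have hx' : (0 : ℝ) < x := hx
    rw [hf]
    simp only [Real.rpow_one]
    rw [show x / 2 = 1 / 2 * x by ring, Real.mul_rpow (by norm_num) hx'.le]
    ring_nf
  have hf0 : ∀ x ∈ Set.Ioi (0 : ℝ), 0 ≤ f x := fun x hx => by
    have hx' : (0 : ℝ) < x := hx
    positivity
  have hI : 0 ≤ ∫ x in Set.Ioi (0 : ℝ), f x := setIntegral_nonneg measurableSet_Ioi hf0
  refine ⟨C ^ 2 / π ^ 4 * (∫ x in Set.Ioi (0 : ℝ), f x) + 1, by positivity, fun l _ => ?_⟩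
  set ω : ℝ := (2 * (l : ℝ) + 1) * π with hω
  have hcos : Real.cos (ω * (1 / 2)) = 0 := by
    rw [Real.cos_eq_zero_iff]
    exact ⟨l, by rw [hω]; push_cast; ring⟩
  calc _ ≤ ∫⁻ x in Set.Ioi (0 : ℝ), ENNReal.ofReal (C ^ 2 / ω ^ 4 * f x) := by
        refine setLIntegral_mono' measurableSet_Ioi fun x hx => ?_
        have hx' : (0 : ℝ) < x := hx
        rw [← enorm_eq_nnnorm, ← ofReal_norm, ← ENNReal.ofReal_pow (norm_nonneg _)]
        refine ENNReal.ofReal_le_ofReal ?_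
        refine (pow_le_pow_left₀ (norm_nonneg _)
          (hbound ω x (by positivity) hcos hx') 2).trans_eq ?_
        have e1 : ((x / 2) ^ (-ρ.re)) ^ 2 = (x / 2) ^ (-2 * ρ.re) := by
          rw [← Real.rpow_natCast, ← Real.rpow_mul (by positivity)]
          push_cast
          ring_nf
        have e2 : Real.exp (-x * (1 / 2)) ^ 2 = Real.exp (-x) := by
          rw [← Real.exp_nat_mul]
          push_cast
          ring_nf
        rw [div_pow, mul_pow, mul_pow, e1, e2, hf]
        ring
    _ = ENNReal.ofReal (C ^ 2 / ω ^ 4 * ∫ x in Set.Ioi (0 : ℝ), f x) := by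
        rw [← integral_const_mul, ofReal_integral_eq_lintegral_ofReal (hfint.const_mul _)]
        exact ae_restrict_of_forall_mem measurableSet_Ioi fun x hx =>
          mul_nonneg (by positivity) (hf0 x hx)
    _ ≤ _ := by
        refine ENNReal.ofReal_le_ofReal ?_
        rw [le_div_iff₀ (by positivity), hω]
        have : C ^ 2 / ((2 * (l : ℝ) + 1) * π) ^ 4 * (∫ x in Set.Ioi (0 : ℝ), f x) *
            (2 * l + 1) ^ 4 = C ^ 2 / π ^ 4 * ∫ x in Set.Ioi (0 : ℝ), f x := by
          field_simp
        linarith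
end

section
/- Let ρ be a nontrivial zero of the Riemann zeta function. Then for every x > 0, F_ρ is differentiable at x and satisfies the eigenfunction equation −x·F_ρ′(x) = ρ·F_ρ(x) + Σ_{n=1}^∞ η(n·x). -/
open MeasureTheory Real Filter

/-- The theta-like series `∑_{n ≥ 1} η(n·y)`. -/
noncomputable def etaSum (y : ℝ) : ℂ := ∑' n : ℕ, (eta (((n : ℝ) + 1) * y) : ℂ)

lemma abs_eta_le {y : ℝ} (hy : 0 < y) : |eta y| ≤ 72 / y ^ 2 := by
  have hz : 0 ≤ π * y ^ 2 := by positivity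
  have h2 := Real.pow_div_factorial_le_exp (π * y ^ 2) hz 2
  have h3 := Real.pow_div_factorial_le_exp (π * y ^ 2) hz 3
  have hπ : (1 : ℝ) ≤ π := by linarith [Real.pi_gt_three]
  rw [le_div_iff₀ (by positivity)]
  have hE : Real.exp (-π * y ^ 2) = (Real.exp (π * y ^ 2))⁻¹ := by
    rw [← Real.exp_neg]; ring_nf
  have hpos := Real.exp_pos (π * y ^ 2)
  have habs : |π * y ^ 2 - 3 / 2| ≤ π * y ^ 2 + 3 / 2 := by
    rw [abs_le]; constructor <;> linarith
  unfold eta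
  rw [hE, abs_mul, abs_mul, abs_of_nonneg (by positivity : 0 ≤ 8 * π * y ^ 2),
    abs_of_pos (inv_pos.mpr hpos)]
  norm_num [Nat.factorial] at h2 h3
  have hstep : 8 * π * y ^ 2 * |π * y ^ 2 - 3 / 2| * y ^ 2 ≤ 72 * Real.exp (π * y ^ 2) := by
    calc 8 * π * y ^ 2 * |π * y ^ 2 - 3 / 2| * y ^ 2
        ≤ 8 * π * y ^ 2 * (π * y ^ 2 + 3 / 2) * (π * y ^ 2) := by
          gcongr
          nlinarith [sq_nonneg y]
      _ = 8 * (π * y ^ 2) ^ 3 + 12 * (π * y ^ 2) ^ 2 := by ring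
      _ ≤ 72 * Real.exp (π * y ^ 2) := by linarith
  calc 8 * π * y ^ 2 * |π * y ^ 2 - 3 / 2| * (Real.exp (π * y ^ 2))⁻¹ * y ^ 2
      = (8 * π * y ^ 2 * |π * y ^ 2 - 3 / 2| * y ^ 2) / Real.exp (π * y ^ 2) := by ring
    _ ≤ 72 := by rwa [div_le_iff₀ hpos]

lemma norm_eta_mul_le {a y : ℝ} (ha : 0 < a) (hay : a ≤ y) (n : ℕ) :
    ‖(eta (((n : ℝ) + 1) * y) : ℂ)‖ ≤ 72 / a ^ 2 * (1 / ((n : ℝ) + 1) ^ 2) := by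
  have hy : 0 < y := ha.trans_le hay
  rw [Complex.norm_real, Real.norm_eq_abs]
  calc |eta (((n : ℝ) + 1) * y)| ≤ 72 / (((n : ℝ) + 1) * y) ^ 2 := abs_eta_le (by positivity)
    _ ≤ 72 / (((n : ℝ) + 1) * a) ^ 2 := by gcongr
    _ = 72 / a ^ 2 * (1 / ((n : ℝ) + 1) ^ 2) := by field_simp

lemma summable_one_div_succ_sq : Summable fun n : ℕ => 1 / ((n : ℝ) + 1) ^ 2 := by
  have h := (summable_nat_add_iff 1).mpr (Real.summable_one_div_nat_pow.mpr one_lt_two)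
  simpa using h

lemma continuousOn_etaSum : ContinuousOn etaSum (Set.Ioi 0) := by
  intro y hy
  have hy : 0 < y := hy
  have h : ContinuousOn etaSum (Set.Ici (y / 2)) := by
    refine continuousOn_tsum (fun n => ?_)
      (summable_one_div_succ_sq.mul_left (72 / (y / 2) ^ 2))
      (fun n z hz => norm_eta_mul_le (by positivity) hz n)
    unfold eta
    fun_prop
  exact (h.continuousAt (Ici_mem_nhds (by linarith))).continuousWithinAt

lemma norm_etaSum_le {y : ℝ} (hy : 0 < y) :
    ‖etaSum y‖ ≤ 72 * (∑' n : ℕ, 1 / ((n : ℝ) + 1) ^ 2) * y ^ (-2 : ℝ) := by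
  have h := tsum_of_norm_bounded
    (summable_one_div_succ_sq.mul_left (72 / y ^ 2)).hasSum
    (fun n => norm_eta_mul_le hy le_rfl n)
  rw [tsum_mul_left] at h
  refine h.trans (le_of_eq ?_)
  rw [Real.rpow_neg hy.le, Real.rpow_two]
  ring

lemma continuousOn_etaSum_mul_cpow (ρ : ℂ) :
    ContinuousOn (fun u : ℝ => etaSum u * (u : ℂ) ^ (ρ - 1)) (Set.Ioi 0) :=
  continuousOn_etaSum.mul fun u hu =>
    (Complex.continuousAt_ofReal_cpow_const u _ (Or.inr (ne_of_gt hu))).continuousWithinAt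

lemma integrableOn_etaSum_mul_cpow {ρ : ℂ} (hρ : ρ.re < 2) {a : ℝ} (ha : 0 < a) :
    IntegrableOn (fun u : ℝ => etaSum u * (u : ℂ) ^ (ρ - 1)) (Set.Ioi a) := by
  have hb := (integrableOn_Ioi_rpow_of_lt (show ρ.re - 3 < -1 by linarith) ha).const_mul
    (72 * ∑' n : ℕ, 1 / ((n : ℝ) + 1) ^ 2)
  refine Integrable.mono' hb
    (((continuousOn_etaSum_mul_cpow ρ).mono (Set.Ioi_subset_Ioi ha.le)).aestronglyMeasurable
      measurableSet_Ioi) ?_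
  refine (ae_restrict_iff' measurableSet_Ioi).mpr (Eventually.of_forall fun u hu => ?_)
  have hu : 0 < u := ha.trans hu
  rw [norm_mul, Complex.norm_cpow_eq_rpow_re_of_pos hu]
  calc ‖etaSum u‖ * u ^ (ρ - 1).re
      ≤ 72 * (∑' n : ℕ, 1 / ((n : ℝ) + 1) ^ 2) * u ^ (-2 : ℝ) * u ^ (ρ - 1).re := by
        gcongr
        exact norm_etaSum_le hu
    _ = 72 * (∑' n : ℕ, 1 / ((n : ℝ) + 1) ^ 2) * u ^ (ρ.re - 3) := by
        rw [mul_assoc, ← Real.rpow_add hu]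
        congr 2
        simp only [Complex.sub_re, Complex.one_re]
        ring

lemma F_eq_cpow_mul_integral (ρ : ℂ) {x : ℝ} (hx : 0 < x) :
    F ρ x = (x : ℂ) ^ (-ρ) * ∫ u in Set.Ioi x, etaSum u * (u : ℂ) ^ (ρ - 1) := by
  have hxC : (x : ℂ) ≠ 0 := Complex.ofReal_ne_zero.mpr hx.ne'
  have h := integral_comp_mul_left_Ioi (fun u : ℝ => etaSum u * (u : ℂ) ^ (ρ - 1)) 1 hx
  have hF : ∫ t in Set.Ioi (1 : ℝ), etaSum (x * t) * ((x * t : ℝ) : ℂ) ^ (ρ - 1) =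
      (x : ℂ) ^ (ρ - 1) * F ρ x := by
    rw [F, ← integral_const_mul]
    refine setIntegral_congr_fun measurableSet_Ioi fun t ht => ?_
    have ht : 0 ≤ t := zero_le_one.trans (le_of_lt ht)
    simp only [etaSum]
    rw [Complex.ofReal_mul, Complex.mul_cpow_ofReal_nonneg hx.le ht]
    simp only [mul_assoc, mul_comm x t]
    ring
  rw [hF, mul_one, Complex.real_smul] at h
  have hinv : (x : ℂ) ^ (-ρ) * (x : ℂ) ^ ρ = 1 := by
    rw [← Complex.cpow_add _ _ hxC]; simp
  rw [Complex.cpow_sub _ _ hxC, Complex.cpow_one, Complex.ofReal_inv] at h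
  field_simp at h
  rw [← h, ← mul_assoc, hinv, one_mul]

/-- The fundamental theorem of calculus for the lower endpoint of an integral over `Ioi`. -/
lemma hasDerivAt_integral_Ioi {f : ℝ → ℂ} {a x : ℝ} (hax : a < x)
    (hint : IntegrableOn f (Set.Ioi a)) (hcont : ContinuousOn f (Set.Ioi a)) :
    HasDerivAt (fun y => ∫ u in Set.Ioi y, f u) (-f x) x := by
  have hmem : Set.Ioi a ∈ nhds x := Ioi_mem_nhds hax
  have hii : ∀ y, a < y → IntervalIntegrable f volume a y := fun y hy =>
    (intervalIntegrable_iff_integrableOn_Ioc_of_le hy.le).mpr (hint.mono_set Set.Ioc_subset_Ioi_self)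
  have hd := intervalIntegral.integral_hasDerivAt_right (hii x hax)
    (hcont.stronglyMeasurableAtFilter isOpen_Ioi x hax) (hcont.continuousAt hmem)
  refine (hd.const_sub (∫ u in Set.Ioi a, f u)).congr_of_eventuallyEq ?_
  filter_upwards [hmem] with y hy
  rw [← intervalIntegral.integral_interval_add_Ioi hint (hint.mono_set (Set.Ioi_subset_Ioi (le_of_lt hy)))]
  ring

theorem stmt_13 (ρ : ℂ) (hζ : riemannZeta ρ = 0) (hρ0 : 0 < ρ.re) (hρ1 : ρ.re < 1)
    (x : ℝ) (hx : 0 < x) :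
    ∃ F' : ℂ, HasDerivAt (F ρ) F' x ∧
      -(x : ℂ) * F' = ρ * F ρ x + ∑' n : ℕ, (eta (((n : ℝ) + 1) * x) : ℂ) := by
  have hxC : (x : ℂ) ≠ 0 := Complex.ofReal_ne_zero.mpr hx.ne'
  have hρ : ρ ≠ 0 := fun h => by simp [h] at hρ0
  have hG := hasDerivAt_integral_Ioi (half_lt_self hx)
    (integrableOn_etaSum_mul_cpow (hρ1.trans one_lt_two) (half_pos hx))
    ((continuousOn_etaSum_mul_cpow ρ).mono (Set.Ioi_subset_Ioi (half_pos hx).le))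
  have hpow : HasDerivAt (fun y : ℝ => (y : ℂ) ^ (-ρ)) (-ρ * (x : ℂ) ^ (-ρ - 1)) x :=
    hasDerivAt_ofReal_cpow_const hx.ne' (neg_ne_zero.mpr hρ)
  refine ⟨_, (hpow.mul hG).congr_of_eventuallyEq ?_, ?_⟩
  · filter_upwards [Ioi_mem_nhds hx] with y hy
    exact F_eq_cpow_mul_integral ρ hy
  · rw [F_eq_cpow_mul_integral ρ hx]
    change _ = _ + etaSum x
    have hinv : (x : ℂ) ^ (-ρ) * (x : ℂ) ^ ρ = 1 := by
      rw [← Complex.cpow_add _ _ hxC]; simp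
    rw [Complex.cpow_sub _ _ hxC, Complex.cpow_sub _ _ hxC, Complex.cpow_one]
    field_simp
    linear_combination etaSum x * hinv
end

section
/- There exists a constant C > 0 such that for every complex number s with 0 < Re(s) < 1, every positive integer m and every positive integer l, |∫_{−1/2}^{1/2} (sin((2l+1)πt)/sin(πt))·(∫₁^{1+t/m} u^{−s−1} du) dt| ≤ C·(|s|+1)²/(m·(2l+1)²). -/
open MeasureTheory Real Filter

lemma intervalIntegrable_of_continuousOn_Ioc_of_bound {f : ℝ → ℂ} {a b M : ℝ} (hab : a ≤ b)
    (hf : ContinuousOn f (Set.Ioc a b)) (hM : ∀ t ∈ Set.Ioc a b, ‖f t‖ ≤ M) :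
    IntervalIntegrable f volume a b := by
  rw [intervalIntegrable_iff_integrableOn_Ioc_of_le hab]
  refine Integrable.mono' (integrable_const M) (hf.aestronglyMeasurable measurableSet_Ioc) ?_
  filter_upwards [ae_restrict_mem measurableSet_Ioc] with t ht using hM t ht

lemma two_mul_le_sin_pi_mul {t : ℝ} (h0 : 0 ≤ t) (h1 : t ≤ 1 / 2) : 2 * t ≤ sin (π * t) := by
  have h := mul_le_sin (x := π * t) (by positivity) (by nlinarith [pi_pos])
  calc 2 * t = 2 / π * (π * t) := by field_simp
    _ ≤ _ := h

/-- The first derivative of `t ↦ 1 / sin (π t)`. -/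
noncomputable def cscPiDeriv (t : ℝ) : ℝ := -(π * cos (π * t)) / sin (π * t) ^ 2

/-- The second derivative of `t ↦ 1 / sin (π t)`. -/
noncomputable def cscPiDerivTwo (t : ℝ) : ℝ :=
  π ^ 2 / sin (π * t) + 2 * π ^ 2 * cos (π * t) ^ 2 / sin (π * t) ^ 3

lemma hasDerivAt_sin_mul (a t : ℝ) : HasDerivAt (fun t => sin (a * t)) (a * cos (a * t)) t := by
  simpa [mul_comm] using ((hasDerivAt_id t).const_mul a).sin

lemma hasDerivAt_cos_mul (a t : ℝ) :
    HasDerivAt (fun t => cos (a * t)) (-(a * sin (a * t))) t := by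
  simpa [mul_comm] using ((hasDerivAt_id t).const_mul a).cos

lemma hasDerivAt_inv_sin_pi_mul {t : ℝ} (h : sin (π * t) ≠ 0) :
    HasDerivAt (fun t => (sin (π * t))⁻¹) (cscPiDeriv t) t :=
  (hasDerivAt_sin_mul π t).inv h

lemma hasDerivAt_cscPiDeriv {t : ℝ} (h : sin (π * t) ≠ 0) :
    HasDerivAt cscPiDeriv (cscPiDerivTwo t) t := by
  have h1 := (((hasDerivAt_cos_mul π t).const_mul π).neg).div
    ((hasDerivAt_sin_mul π t).pow 2) (pow_ne_zero 2 h)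
  refine h1.congr_deriv ?_
  simp only [cscPiDerivTwo, Pi.pow_apply, Pi.neg_apply]
  field_simp
  push_cast
  ring

lemma abs_inv_sin_pi_mul_le {t : ℝ} (h0 : 0 < t) (h1 : t ≤ 1 / 2) :
    |(sin (π * t))⁻¹| ≤ 1 / (2 * t) := by
  have hS := two_mul_le_sin_pi_mul h0.le h1
  rw [abs_of_nonneg (by have : 0 < 2 * t := by positivity
                        exact inv_nonneg.2 (by linarith)), ← one_div]
  gcongr

lemma abs_cscPiDeriv_le {t : ℝ} (h0 : 0 < t) (h1 : t ≤ 1 / 2) :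
    |cscPiDeriv t| ≤ 1 / t ^ 2 := by
  have h := abs_inv_sin_pi_mul_le h0 h1
  calc |cscPiDeriv t| = π * |cos (π * t)| * |(sin (π * t))⁻¹| ^ 2 := by
        rw [cscPiDeriv, div_eq_mul_inv, abs_mul, abs_neg, abs_mul, abs_of_pos pi_pos,
          ← inv_pow, abs_pow]
    _ ≤ 4 * 1 * (1 / (2 * t)) ^ 2 := by
        gcongr
        · exact pi_le_four
        · exact abs_cos_le_one _
    _ = 1 / t ^ 2 := by field_simp; norm_num

lemma abs_cscPiDerivTwo_le {t : ℝ} (h0 : 0 < t) (h1 : t ≤ 1 / 2) :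
    |cscPiDerivTwo t| ≤ 6 / t ^ 3 := by
  have h := abs_inv_sin_pi_mul_le h0 h1
  calc |cscPiDerivTwo t|
      ≤ π ^ 2 * |(sin (π * t))⁻¹| + 2 * π ^ 2 * |cos (π * t)| ^ 2 * |(sin (π * t))⁻¹| ^ 3 := by
        rw [cscPiDerivTwo, div_eq_mul_inv, div_eq_mul_inv, ← inv_pow]
        refine (abs_add_le _ _).trans (le_of_eq ?_)
        simp only [abs_mul, abs_pow, abs_of_pos pi_pos, abs_two]
    _ ≤ 4 ^ 2 * (1 / (2 * t)) + 2 * 4 ^ 2 * 1 ^ 2 * (1 / (2 * t)) ^ 3 := by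
        gcongr
        · exact pi_le_four
        · exact pi_le_four
        · exact abs_cos_le_one _
    _ = (8 * t ^ 2 + 4) / t ^ 3 := by field_simp; ring
    _ ≤ 6 / t ^ 3 := by gcongr; nlinarith

/-- Integrating by parts twice: if `R` vanishes to third order at `0`, its integral against the
Dirichlet kernel of odd frequency `2 l + 1` over `[0, 1/2]` is `O((2 l + 1)⁻²)`. -/
lemma norm_integral_dirichlet_mul_le {R R₁ R₂ : ℝ → ℂ} {B : ℝ} (l : ℕ)
    (hR : ∀ t ∈ Set.Icc (0 : ℝ) (1 / 2), HasDerivAt R (R₁ t) t)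
    (hR₁ : ∀ t ∈ Set.Icc (0 : ℝ) (1 / 2), HasDerivAt R₁ (R₂ t) t)
    (hR₂ : ContinuousOn R₂ (Set.Icc 0 (1 / 2)))
    (bR : ∀ t ∈ Set.Icc (0 : ℝ) (1 / 2), ‖R t‖ ≤ B * t ^ 3)
    (bR₁ : ∀ t ∈ Set.Icc (0 : ℝ) (1 / 2), ‖R₁ t‖ ≤ B * t ^ 2)
    (bR₂ : ∀ t ∈ Set.Icc (0 : ℝ) (1 / 2), ‖R₂ t‖ ≤ B * t) :
    IntervalIntegrable (fun t => (sin ((2 * (l : ℝ) + 1) * π * t) / sin (π * t)) • R t)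
        volume 0 (1 / 2) ∧
      ‖∫ t in (0 : ℝ)..(1 / 2), (sin ((2 * (l : ℝ) + 1) * π * t) / sin (π * t)) • R t‖
        ≤ B / (2 * l + 1) ^ 2 := by
  set w : ℝ := (2 * (l : ℝ) + 1) * π with hw
  have hw0 : 0 < w := by positivity
  have hB : 0 ≤ B := by
    have := (norm_nonneg _).trans (bR₂ (1 / 2) (by norm_num)); linarith
  let Q : ℝ → ℂ := fun t => (sin (π * t))⁻¹ • R t
  let Q₁ : ℝ → ℂ := fun t => (sin (π * t))⁻¹ • R₁ t + cscPiDeriv t • R t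
  let Q₂ : ℝ → ℂ := fun t => ((sin (π * t))⁻¹ • R₂ t + cscPiDeriv t • R₁ t) +
    (cscPiDeriv t • R₁ t + cscPiDerivTwo t • R t)
  have hI : ∀ t ∈ Set.Ioc (0 : ℝ) (1 / 2), t ∈ Set.Icc (0 : ℝ) (1 / 2) :=
    fun t ht => Set.Ioc_subset_Icc_self ht
  have hS : ∀ t ∈ Set.Ioc (0 : ℝ) (1 / 2), sin (π * t) ≠ 0 := fun t ht => by
    have := two_mul_le_sin_pi_mul ht.1.le ht.2
    have := ht.1
    linarith
  have hQ : ∀ t ∈ Set.Ioc (0 : ℝ) (1 / 2), HasDerivAt Q (Q₁ t) t := fun t ht =>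
    (hasDerivAt_inv_sin_pi_mul (hS t ht)).smul (hR t (hI t ht))
  have hQ₁ : ∀ t ∈ Set.Ioc (0 : ℝ) (1 / 2), HasDerivAt Q₁ (Q₂ t) t := fun t ht =>
    ((hasDerivAt_inv_sin_pi_mul (hS t ht)).smul (hR₁ t (hI t ht))).add
      ((hasDerivAt_cscPiDeriv (hS t ht)).smul (hR t (hI t ht)))
  have bQ : ∀ t ∈ Set.Ioc (0 : ℝ) (1 / 2), ‖Q t‖ ≤ B * t := fun t ht => by
    have h0 := ht.1
    calc ‖Q t‖ = |(sin (π * t))⁻¹| * ‖R t‖ := by rw [norm_smul, norm_eq_abs]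
      _ ≤ 1 / (2 * t) * (B * t ^ 3) := by
        gcongr
        · exact abs_inv_sin_pi_mul_le ht.1 ht.2
        · exact bR t (hI t ht)
      _ = B * t * (t / 2) := by field_simp
      _ ≤ B * t * 1 := by gcongr; linarith [ht.2]
      _ = B * t := mul_one _
  have bQ₁ : ∀ t ∈ Set.Ioc (0 : ℝ) (1 / 2), ‖Q₁ t‖ ≤ 2 * B * t := fun t ht => by
    have h0 := ht.1
    calc ‖Q₁ t‖ ≤ |(sin (π * t))⁻¹| * ‖R₁ t‖ + |cscPiDeriv t| * ‖R t‖ := by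
          refine (norm_add_le _ _).trans (le_of_eq ?_)
          simp only [norm_smul, norm_eq_abs]
      _ ≤ 1 / (2 * t) * (B * t ^ 2) + 1 / t ^ 2 * (B * t ^ 3) := by
        gcongr
        · exact abs_inv_sin_pi_mul_le ht.1 ht.2
        · exact bR₁ t (hI t ht)
        · exact abs_cscPiDeriv_le ht.1 ht.2
        · exact bR t (hI t ht)
      _ = 3 / 2 * (B * t) := by field_simp; ring
      _ ≤ 2 * B * t := by nlinarith [mul_nonneg hB h0.le]
  have bQ₂ : ∀ t ∈ Set.Ioc (0 : ℝ) (1 / 2), ‖Q₂ t‖ ≤ 9 * B := fun t ht => by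
    have h0 := ht.1
    calc ‖Q₂ t‖ ≤ (|(sin (π * t))⁻¹| * ‖R₂ t‖ + |cscPiDeriv t| * ‖R₁ t‖) +
          (|cscPiDeriv t| * ‖R₁ t‖ + |cscPiDerivTwo t| * ‖R t‖) := by
          simp only [← norm_eq_abs, ← norm_smul]
          exact (norm_add_le _ _).trans (add_le_add (norm_add_le _ _) (norm_add_le _ _))
      _ ≤ (1 / (2 * t) * (B * t) + 1 / t ^ 2 * (B * t ^ 2)) +
          (1 / t ^ 2 * (B * t ^ 2) + 6 / t ^ 3 * (B * t ^ 3)) := by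
        gcongr
        · exact abs_inv_sin_pi_mul_le ht.1 ht.2
        · exact bR₂ t (hI t ht)
        · exact abs_cscPiDeriv_le ht.1 ht.2
        · exact bR₁ t (hI t ht)
        · exact abs_cscPiDeriv_le ht.1 ht.2
        · exact bR₁ t (hI t ht)
        · exact abs_cscPiDerivTwo_le ht.1 ht.2
        · exact bR t (hI t ht)
      _ = 17 / 2 * B := by field_simp; ring
      _ ≤ 9 * B := by linarith
  have cQ : ContinuousOn Q (Set.Ioc 0 (1 / 2)) := fun t ht =>
    (hQ t ht).continuousAt.continuousWithinAt
  have cQ₂ : ContinuousOn Q₂ (Set.Ioc 0 (1 / 2)) := by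
    have c : Continuous fun t : ℝ => sin (π * t) := by fun_prop
    have c' : Continuous fun t : ℝ => cos (π * t) := by fun_prop
    have c0 : ContinuousOn (fun t => (sin (π * t))⁻¹) (Set.Ioc 0 (1 / 2)) :=
      c.continuousOn.inv₀ hS
    have c1 : ContinuousOn cscPiDeriv (Set.Ioc 0 (1 / 2)) := fun t ht =>
      (hasDerivAt_cscPiDeriv (hS t ht)).continuousAt.continuousWithinAt
    have c2 : ContinuousOn cscPiDerivTwo (Set.Ioc 0 (1 / 2)) :=
      (continuousOn_const.div c.continuousOn hS).add
        (((c'.pow 2).const_mul _).continuousOn.div (c.pow 3).continuousOn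
          fun t ht => pow_ne_zero 3 (hS t ht))
    have r0 : ContinuousOn R (Set.Ioc 0 (1 / 2)) := fun t ht =>
      (hR t (hI t ht)).continuousAt.continuousWithinAt
    have r1 : ContinuousOn R₁ (Set.Ioc 0 (1 / 2)) := fun t ht =>
      (hR₁ t (hI t ht)).continuousAt.continuousWithinAt
    have r2 : ContinuousOn R₂ (Set.Ioc 0 (1 / 2)) := hR₂.mono hI
    exact ((c0.smul r2).add (c1.smul r1)).add ((c1.smul r1).add (c2.smul r0))
  have csin : Continuous fun t : ℝ => sin (w * t) := by fun_prop
  have iQ : IntervalIntegrable (fun t => sin (w * t) • Q t) volume 0 (1 / 2) := by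
    refine intervalIntegrable_of_continuousOn_Ioc_of_bound (M := B) (by norm_num)
      (csin.continuousOn.smul cQ) fun t ht => ?_
    rw [norm_smul]
    have := bQ t ht
    have := abs_sin_le_one (w * t)
    rw [norm_eq_abs]
    nlinarith [norm_nonneg (Q t), ht.2]
  have bsQ₂ : ∀ t ∈ Set.Ioc (0 : ℝ) (1 / 2), ‖sin (w * t) • Q₂ t‖ ≤ 9 * B := fun t ht => by
    rw [norm_smul, norm_eq_abs]
    nlinarith [norm_nonneg (Q₂ t), bQ₂ t ht, abs_sin_le_one (w * t)]
  have iQ₂ : IntervalIntegrable (fun t => sin (w * t) • Q₂ t) volume 0 (1 / 2) :=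
    intervalIntegrable_of_continuousOn_Ioc_of_bound (by norm_num)
      (csin.continuousOn.smul cQ₂) bsQ₂
  let W : ℝ → ℂ := fun t => (-cos (w * t) / w) • Q t + (sin (w * t) / w ^ 2) • Q₁ t
  have hW : ∀ t ∈ Set.Ioc (0 : ℝ) (1 / 2),
      HasDerivAt W (sin (w * t) • Q t + (1 / w ^ 2) • (sin (w * t) • Q₂ t)) t := fun t ht => by
    have h := ((((hasDerivAt_cos_mul w t).neg).div_const w).smul (hQ t ht)).add
      (((hasDerivAt_sin_mul w t).div_const (w ^ 2)).smul (hQ₁ t ht))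
    refine h.congr_deriv ?_
    have e1 : - -(w * sin (w * t)) / w = sin (w * t) := by field_simp
    have e2 : w * cos (w * t) / w ^ 2 = cos (w * t) / w := by field_simp
    simp only [Pi.neg_apply, e1, e2]
    module
  have bW : ∀ t ∈ Set.Ioc (0 : ℝ) (1 / 2), ‖W t‖ ≤ (1 / w * B + 1 / w ^ 2 * (2 * B)) * t :=
    fun t ht => by
    calc ‖W t‖ ≤ |cos (w * t)| / w * ‖Q t‖ + |sin (w * t)| / w ^ 2 * ‖Q₁ t‖ := by
          refine (norm_add_le _ _).trans (le_of_eq ?_)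
          simp only [norm_smul, norm_eq_abs, abs_div, abs_neg, abs_pow, abs_of_pos hw0]
      _ ≤ 1 / w * (B * t) + 1 / w ^ 2 * (2 * B * t) := by
        gcongr
        · exact abs_cos_le_one _
        · exact bQ t ht
        · exact abs_sin_le_one _
        · exact bQ₁ t ht
      _ = _ := by ring
  have tW : Tendsto W (nhdsWithin 0 (Set.Ioi 0)) (nhds 0) := by
    refine squeeze_zero_norm' (a := fun t => (1 / w * B + 1 / w ^ 2 * (2 * B)) * t) ?_ ?_
    · filter_upwards [Ioc_mem_nhdsGT (show (0 : ℝ) < 1 / 2 by norm_num)] with t ht using bW t ht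
    · have : Tendsto (fun t : ℝ => (1 / w * B + 1 / w ^ 2 * (2 * B)) * t) (nhds 0) (nhds 0) := by
        exact (continuous_const_mul (1 / w * B + 1 / w ^ 2 * (2 * B))).tendsto' 0 0 (mul_zero _)
      exact this.mono_left nhdsWithin_le_nhds
  have hhalf : (1 / 2 : ℝ) ∈ Set.Ioc (0 : ℝ) (1 / 2) := by norm_num
  have hFTC := intervalIntegral.integral_eq_sub_of_hasDerivAt_of_tendsto
    (show (0 : ℝ) < 1 / 2 by norm_num) (fun t ht => hW t (Set.Ioo_subset_Ioc_self ht))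
    (iQ.add (iQ₂.smul (1 / w ^ 2))) tW
    ((hW _ hhalf).continuousAt.tendsto.mono_left nhdsWithin_le_nhds)
  have hcos : cos (w * (1 / 2)) = 0 := by
    rw [cos_eq_zero_iff]
    exact ⟨l, by rw [hw]; push_cast; ring⟩
  have hWhalf : ‖W (1 / 2)‖ ≤ 1 / w ^ 2 * B := by
    have e : W (1 / 2) = (sin (w * (1 / 2)) / w ^ 2) • Q₁ (1 / 2) := by
      simp only [W, hcos, neg_zero, zero_div, zero_smul, zero_add]
    rw [e, norm_smul, norm_eq_abs, abs_div, abs_of_pos (pow_pos hw0 2)]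
    gcongr
    · exact abs_sin_le_one _
    · linarith [bQ₁ _ hhalf]
  have hI₂ : ‖∫ t in (0 : ℝ)..(1 / 2), sin (w * t) • Q₂ t‖ ≤ 9 * B * (1 / 2) := by
    have := intervalIntegral.norm_integral_le_of_norm_le_const (a := 0) (b := 1 / 2)
      (f := fun t => sin (w * t) • Q₂ t) (C := 9 * B)
      (fun t ht => bsQ₂ t (by rwa [Set.uIoc_of_le (by norm_num)] at ht))
    simpa using this
  have hfun : (fun t => (sin (w * t) / sin (π * t)) • R t) = fun t => sin (w * t) • Q t := by
    funext t
    simp only [Q, smul_smul, div_eq_mul_inv]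
  rw [hfun]
  refine ⟨iQ, ?_⟩
  have hsplit : ∫ t in (0 : ℝ)..(1 / 2), sin (w * t) • Q t =
      W (1 / 2) - (1 / w ^ 2) • ∫ t in (0 : ℝ)..(1 / 2), sin (w * t) • Q₂ t := by
    rw [eq_sub_iff_add_eq, ← intervalIntegral.integral_smul, ← sub_zero (W (1 / 2)), ← hFTC]
    exact (intervalIntegral.integral_add iQ (iQ₂.smul (1 / w ^ 2))).symm
  rw [hsplit]
  calc _ ≤ ‖W (1 / 2)‖ + 1 / w ^ 2 * ‖∫ t in (0 : ℝ)..(1 / 2), sin (w * t) • Q₂ t‖ := by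
        refine (norm_sub_le _ _).trans (le_of_eq ?_)
        rw [norm_smul, norm_eq_abs, abs_of_pos (a := 1 / w ^ 2) (by positivity)]
    _ ≤ 1 / w ^ 2 * B + 1 / w ^ 2 * (9 * B * (1 / 2)) := by gcongr
    _ = 11 / 2 / π ^ 2 * (B / (2 * l + 1) ^ 2) := by rw [hw]; field_simp; ring
    _ ≤ 1 * (B / (2 * l + 1) ^ 2) := by
        gcongr
        rw [div_le_one (by positivity)]
        nlinarith [pi_gt_three]
    _ = _ := one_mul _

lemma norm_le_mul_pow_succ_of_deriv_le {f f' : ℝ → ℂ} {B b : ℝ} {n : ℕ} (hB : 0 ≤ B)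
    (hf : ∀ t ∈ Set.Icc 0 b, HasDerivAt f (f' t) t) (hf0 : f 0 = 0)
    (hf' : ∀ t ∈ Set.Icc 0 b, ‖f' t‖ ≤ B * t ^ n) :
    ∀ t ∈ Set.Icc 0 b, ‖f t‖ ≤ B * t ^ (n + 1) := by
  intro t ht
  have h := norm_image_sub_le_of_norm_deriv_le_segment' (f := f) (f' := f') (a := 0) (b := t)
    (C := B * t ^ n)
    (fun x hx => (hf x ⟨hx.1, hx.2.trans ht.2⟩).hasDerivWithinAt)
    (fun x hx => (hf' x ⟨hx.1, hx.2.le.trans ht.2⟩).trans (by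
      have := hx.1
      have := hx.2.le
      gcongr)) t ⟨ht.1, le_rfl⟩
  rw [hf0, sub_zero, sub_zero] at h
  exact h.trans_eq (by ring)

lemma half_le_one_add_mul {ε t : ℝ} (hε : |ε| ≤ 1) (ht : t ∈ Set.Icc (0 : ℝ) (1 / 2)) :
    1 / 2 ≤ 1 + ε * t := by
  have h := abs_le.1 hε
  nlinarith [ht.1, ht.2]

lemma hasDerivAt_one_add_mul_cpow {ε t : ℝ} (r : ℂ) (h : 0 < 1 + ε * t) :
    HasDerivAt (fun t : ℝ => ((1 + ε * t : ℝ) : ℂ) ^ r)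
      (r * ε * ((1 + ε * t : ℝ) : ℂ) ^ (r - 1)) t := by
  have h1 : HasDerivAt (fun t : ℝ => 1 + ε * t) ε t := by
    simpa using ((hasDerivAt_id t).const_mul ε).const_add 1
  have h2 : HasDerivAt (fun z : ℂ => z ^ r) (r * ((1 + ε * t : ℝ) : ℂ) ^ (r - 1) * 1)
      ((1 + ε * t : ℝ) : ℂ) :=
    (hasDerivAt_id _).cpow_const (Complex.ofReal_mem_slitPlane.2 h)
  have h3 := h2.comp t h1.ofReal_comp
  refine h3.congr_deriv ?_
  ring

lemma integral_cpow_one_add_mul {s : ℂ} (hs : 0 < s.re) {ε t : ℝ} (h : 0 < 1 + ε * t) :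
    ∫ u in (1 : ℝ)..(1 + ε * t), (u : ℂ) ^ (-s - 1) =
      (1 - ((1 + ε * t : ℝ) : ℂ) ^ (-s)) / s := by
  have hs0 : s ≠ 0 := by rintro rfl; simp at hs
  rw [integral_cpow (Or.inr ⟨by simpa [sub_eq_add_neg] using hs0,
    by rw [Set.mem_uIcc]; rintro (h' | h') <;> linarith [h'.1, h'.2]⟩)]
  rw [show -s - 1 + 1 = -s by ring, Complex.ofReal_one, Complex.one_cpow, div_neg, ← neg_div,
    neg_sub]

/-- The remainder of `∫ u in 1..(1 + ε t), u ^ (-s - 1)` at `t = 0` after removing a combination of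
`sin (π t)` and `sin (π t) ^ 2` that agrees with it to second order. -/
noncomputable def powRemainder (s : ℂ) (ε t : ℝ) : ℂ :=
  (1 - ((1 + ε * t : ℝ) : ℂ) ^ (-s)) / s - ε / π * (sin (π * t) : ℝ)
    + ε ^ 2 * (s + 1) / (2 * π ^ 2) * ((sin (π * t) ^ 2 : ℝ) : ℂ)

/-- The first derivative of `powRemainder`. -/
noncomputable def powRemainderDeriv (s : ℂ) (ε t : ℝ) : ℂ :=
  ε * ((1 + ε * t : ℝ) : ℂ) ^ (-s - 1) - ε * (cos (π * t) : ℝ)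
    + ε ^ 2 * (s + 1) / (2 * π) * (sin (2 * π * t) : ℝ)

/-- The second derivative of `powRemainder`. -/
noncomputable def powRemainderDerivTwo (s : ℂ) (ε t : ℝ) : ℂ :=
  -ε ^ 2 * (s + 1) * ((1 + ε * t : ℝ) : ℂ) ^ (-s - 2) + ε * π * (sin (π * t) : ℝ)
    + ε ^ 2 * (s + 1) * (cos (2 * π * t) : ℝ)

/-- The third derivative of `powRemainder`. -/
noncomputable def powRemainderDerivThree (s : ℂ) (ε t : ℝ) : ℂ :=
  ε ^ 3 * (s + 1) * (s + 2) * ((1 + ε * t : ℝ) : ℂ) ^ (-s - 3) + ε * π ^ 2 * (cos (π * t) : ℝ)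
    - 2 * π * ε ^ 2 * (s + 1) * (sin (2 * π * t) : ℝ)

lemma hasDerivAt_powRemainder {s : ℂ} (hs : s ≠ 0) {ε t : ℝ} (h : 0 < 1 + ε * t) :
    HasDerivAt (powRemainder s ε) (powRemainderDeriv s ε t) t := by
  have hπ : (π : ℂ) ≠ 0 := by exact_mod_cast pi_ne_zero
  have h1 := ((((hasDerivAt_one_add_mul_cpow (-s) h).const_sub 1).div_const s).sub
    ((hasDerivAt_sin_mul π t).ofReal_comp.const_mul (ε / π : ℂ))).add
    (((hasDerivAt_sin_mul π t).pow 2).ofReal_comp.const_mul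
      (ε ^ 2 * (s + 1) / (2 * π ^ 2) : ℂ))
  refine h1.congr_deriv ?_
  rw [powRemainderDeriv, show 2 * π * t = 2 * (π * t) by ring, sin_two_mul]
  push_cast
  field_simp

lemma hasDerivAt_powRemainderDeriv (s : ℂ) {ε t : ℝ} (h : 0 < 1 + ε * t) :
    HasDerivAt (powRemainderDeriv s ε) (powRemainderDerivTwo s ε t) t := by
  have hπ : (π : ℂ) ≠ 0 := by exact_mod_cast pi_ne_zero
  have h1 := (((hasDerivAt_one_add_mul_cpow (-s - 1) h).const_mul (ε : ℂ)).sub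
    ((hasDerivAt_cos_mul π t).ofReal_comp.const_mul (ε : ℂ))).add
    ((hasDerivAt_sin_mul (2 * π) t).ofReal_comp.const_mul
      (ε ^ 2 * (s + 1) / (2 * π) : ℂ))
  refine h1.congr_deriv ?_
  rw [powRemainderDerivTwo, show -s - 1 - 1 = -s - 2 by ring]
  push_cast
  field_simp
  ring

lemma hasDerivAt_powRemainderDerivTwo (s : ℂ) {ε t : ℝ} (h : 0 < 1 + ε * t) :
    HasDerivAt (powRemainderDerivTwo s ε) (powRemainderDerivThree s ε t) t := by
  have h1 := (((hasDerivAt_one_add_mul_cpow (-s - 2) h).const_mul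
    (-ε ^ 2 * (s + 1) : ℂ)).add
    ((hasDerivAt_sin_mul π t).ofReal_comp.const_mul (ε * π : ℂ))).add
    ((hasDerivAt_cos_mul (2 * π) t).ofReal_comp.const_mul (ε ^ 2 * (s + 1) : ℂ))
  refine h1.congr_deriv ?_
  rw [powRemainderDerivThree, show -s - 2 - 1 = -s - 3 by ring]
  push_cast
  ring

lemma norm_powRemainderDerivThree_le {s : ℂ} (h0 : 0 < s.re) (h1 : s.re < 1) {ε t : ℝ}
    (hε : |ε| ≤ 1) (ht : t ∈ Set.Icc (0 : ℝ) (1 / 2)) :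
    ‖powRemainderDerivThree s ε t‖ ≤ 56 * |ε| * (‖s‖ + 1) ^ 2 := by
  have hx := half_le_one_add_mul hε ht
  have hx0 : 0 < 1 + ε * t := by linarith
  have hpow : ‖((1 + ε * t : ℝ) : ℂ) ^ (-s - 3)‖ ≤ 16 := by
    rw [Complex.norm_cpow_eq_rpow_re_of_pos hx0]
    have hre : (-s - 3).re = -(s.re + 3) := by simp; ring
    rw [hre]
    calc (1 + ε * t) ^ (-(s.re + 3)) ≤ (1 / 2 : ℝ) ^ (-(s.re + 3)) :=
          rpow_le_rpow_of_nonpos (by norm_num) hx (by linarith)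
      _ = 2 ^ (s.re + 3) := by
          rw [rpow_neg (by norm_num), one_div, inv_rpow (by norm_num), inv_inv]
      _ ≤ 2 ^ (4 : ℝ) := rpow_le_rpow_of_exponent_le (by norm_num) (by linarith)
      _ = 16 := by norm_num
  have hs1 : ‖s + 1‖ ≤ ‖s‖ + 1 := (norm_add_le _ _).trans_eq (by simp)
  have hs2 : ‖s + 2‖ ≤ 2 * (‖s‖ + 1) :=
    (norm_add_le _ _).trans (by rw [Complex.norm_ofNat]; linarith [norm_nonneg s])
  have hε2 : |ε| ^ 2 ≤ |ε| := by nlinarith [abs_nonneg ε]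
  have hε3 : |ε| ^ 3 ≤ |ε| := by nlinarith [abs_nonneg ε]
  have hn : 1 ≤ ‖s‖ + 1 := by linarith [norm_nonneg s]
  calc ‖powRemainderDerivThree s ε t‖
      ≤ |ε| ^ 3 * ‖s + 1‖ * ‖s + 2‖ * ‖((1 + ε * t : ℝ) : ℂ) ^ (-s - 3)‖
          + |ε| * π ^ 2 * |cos (π * t)| + 2 * π * |ε| ^ 2 * ‖s + 1‖ * |sin (2 * π * t)| := by
        refine (norm_sub_le _ _).trans ((add_le_add_left (norm_add_le _ _) _).trans
          (le_of_eq ?_))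
        simp only [norm_mul, norm_pow, Complex.norm_real, norm_eq_abs, abs_of_pos pi_pos,
          Complex.norm_ofNat]
    _ ≤ |ε| * (‖s‖ + 1) * (2 * (‖s‖ + 1)) * 16 + |ε| * 4 ^ 2 * 1
          + 2 * 4 * |ε| * (‖s‖ + 1) * 1 := by
        gcongr
        · exact pi_le_four
        · exact abs_cos_le_one _
        · exact pi_le_four
        · exact abs_sin_le_one _
    _ = |ε| * (32 * (‖s‖ + 1) ^ 2 + 16 + 8 * (‖s‖ + 1)) := by ring
    _ ≤ |ε| * (56 * (‖s‖ + 1) ^ 2) := by gcongr; nlinarith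
    _ = _ := by ring

lemma integral_sin_odd_mul_sin_eq_zero {l : ℕ} (hl : 0 < l) :
    ∫ t in (0 : ℝ)..(1 / 2), sin ((2 * (l : ℝ) + 1) * π * t) * sin (π * t) = 0 := by
  have hl' : (l : ℝ) ≠ 0 := by positivity
  have hl1 : (l : ℝ) + 1 ≠ 0 := by positivity
  have hd : ∀ t ∈ Set.uIcc (0 : ℝ) (1 / 2), HasDerivAt
      (fun t => sin (2 * l * π * t) / (4 * l * π) -
        sin (2 * (l + 1) * π * t) / (4 * (l + 1) * π))
      (sin ((2 * (l : ℝ) + 1) * π * t) * sin (π * t)) t := fun t _ => by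
    refine (((hasDerivAt_sin_mul (2 * l * π) t).div_const (4 * l * π)).sub
      ((hasDerivAt_sin_mul (2 * (l + 1) * π) t).div_const (4 * (l + 1) * π))).congr_deriv ?_
    rw [show 2 * l * π * t = (2 * (l : ℝ) + 1) * π * t - π * t by ring,
      show 2 * (l + 1) * π * t = (2 * (l : ℝ) + 1) * π * t + π * t by ring, cos_sub, cos_add]
    field_simp
    ring
  rw [intervalIntegral.integral_eq_sub_of_hasDerivAt hd
    (Continuous.intervalIntegrable (by fun_prop) _ _)]
  have e1 : sin (2 * l * π * (1 / 2)) = 0 := by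
    rw [show 2 * l * π * (1 / 2) = l * π by ring, sin_nat_mul_pi]
  have e2 : sin (2 * (l + 1) * π * (1 / 2)) = 0 := by
    rw [show 2 * ((l : ℝ) + 1) * π * (1 / 2) = ((l + 1 : ℕ) : ℝ) * π by push_cast; ring,
      sin_nat_mul_pi]
  rw [e1, e2]
  simp

lemma norm_integral_dirichlet_mul_integral_cpow_sub_le {s : ℂ} (h0 : 0 < s.re) (h1 : s.re < 1)
    {ε : ℝ} (hε : |ε| ≤ 1) {l : ℕ} (hl : 0 < l) :
    IntervalIntegrable (fun t : ℝ =>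
        ((sin ((2 * (l : ℝ) + 1) * π * t) / sin (π * t) : ℝ) : ℂ) *
          ∫ u in (1 : ℝ)..(1 + ε * t), (u : ℂ) ^ (-s - 1)) volume 0 (1 / 2) ∧
      ‖(∫ t in (0 : ℝ)..(1 / 2),
          ((sin ((2 * (l : ℝ) + 1) * π * t) / sin (π * t) : ℝ) : ℂ) *
            ∫ u in (1 : ℝ)..(1 + ε * t), (u : ℂ) ^ (-s - 1)) -
          ε / π * ((∫ t in (0 : ℝ)..(1 / 2), sin ((2 * (l : ℝ) + 1) * π * t) : ℝ) : ℂ)‖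
        ≤ 56 * |ε| * (‖s‖ + 1) ^ 2 / (2 * l + 1) ^ 2 := by
  have hs0 : s ≠ 0 := by rintro rfl; simp at h0
  have hpos : ∀ t ∈ Set.Icc (0 : ℝ) (1 / 2), 0 < 1 + ε * t := fun t ht => by
    linarith [half_le_one_add_mul hε ht]
  have hB : 0 ≤ 56 * |ε| * (‖s‖ + 1) ^ 2 := by positivity
  have b₂ := norm_le_mul_pow_succ_of_deriv_le (n := 0) hB
    (fun t ht => hasDerivAt_powRemainderDerivTwo s (hpos t ht))
    (by simp [powRemainderDerivTwo])
    (fun t ht => by simpa using norm_powRemainderDerivThree_le h0 h1 hε ht)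
  have b₁ := norm_le_mul_pow_succ_of_deriv_le hB
    (fun t ht => hasDerivAt_powRemainderDeriv s (hpos t ht))
    (by simp [powRemainderDeriv]) b₂
  have b₀ := norm_le_mul_pow_succ_of_deriv_le hB
    (fun t ht => hasDerivAt_powRemainder hs0 (hpos t ht))
    (by simp [powRemainder]) b₁
  obtain ⟨hi, hle⟩ := norm_integral_dirichlet_mul_le l
    (fun t ht => hasDerivAt_powRemainder hs0 (hpos t ht))
    (fun t ht => hasDerivAt_powRemainderDeriv s (hpos t ht))
    (fun t ht => (hasDerivAt_powRemainderDerivTwo s (hpos t ht)).continuousAt.continuousWithinAt)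
    b₀ b₁ (fun t ht => by simpa using b₂ t ht)
  have i₁ : IntervalIntegrable (fun t : ℝ =>
      (ε / π : ℂ) * ((sin ((2 * (l : ℝ) + 1) * π * t) : ℝ) : ℂ)) volume 0 (1 / 2) :=
    Continuous.intervalIntegrable (by fun_prop) _ _
  have i₂ : IntervalIntegrable (fun t : ℝ => (ε ^ 2 * (s + 1) / (2 * π ^ 2) : ℂ) *
      ((sin ((2 * (l : ℝ) + 1) * π * t) * sin (π * t) : ℝ) : ℂ)) volume 0 (1 / 2) :=
    Continuous.intervalIntegrable (by fun_prop) _ _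
  have heq : Set.EqOn (fun t : ℝ => (sin ((2 * (l : ℝ) + 1) * π * t) / sin (π * t)) •
        powRemainder s ε t + (ε / π : ℂ) * ((sin ((2 * (l : ℝ) + 1) * π * t) : ℝ) : ℂ) -
        (ε ^ 2 * (s + 1) / (2 * π ^ 2) : ℂ) *
          ((sin ((2 * (l : ℝ) + 1) * π * t) * sin (π * t) : ℝ) : ℂ))
      (fun t : ℝ => ((sin ((2 * (l : ℝ) + 1) * π * t) / sin (π * t) : ℝ) : ℂ) *
        ∫ u in (1 : ℝ)..(1 + ε * t), (u : ℂ) ^ (-s - 1)) (Set.uIcc 0 (1 / 2)) := by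
    intro t ht
    rw [Set.uIcc_of_le (by norm_num)] at ht
    beta_reduce
    rw [integral_cpow_one_add_mul h0 (hpos t ht), powRemainder, Complex.real_smul]
    rcases ht.1.eq_or_lt with rfl | ht0
    · simp
    · have hS : sin (π * t) ≠ 0 := by linarith [two_mul_le_sin_pi_mul ht.1 ht.2]
      have hS' : ((sin (π * t) : ℝ) : ℂ) ≠ 0 := by exact_mod_cast hS
      rw [Complex.ofReal_div, Complex.ofReal_mul, Complex.ofReal_pow]
      field_simp
      ring
  refine ⟨((hi.add i₁).sub i₂).congr (heq.mono Set.uIoc_subset_uIcc), ?_⟩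
  rw [← intervalIntegral.integral_congr heq,
    intervalIntegral.integral_sub (hi.add i₁) i₂, intervalIntegral.integral_add hi i₁,
    intervalIntegral.integral_const_mul, intervalIntegral.integral_const_mul,
    intervalIntegral.integral_ofReal, intervalIntegral.integral_ofReal,
    integral_sin_odd_mul_sin_eq_zero hl]
  simpa using hle

theorem stmt_19 :
    ∃ C > (0 : ℝ), ∀ s : ℂ, 0 < s.re → s.re < 1 → ∀ m : ℕ, 0 < m → ∀ l : ℕ, 0 < l →
      ‖∫ t in (-(1 / 2) : ℝ)..(1 / 2),
          ((Real.sin ((2 * (l : ℝ) + 1) * π * t) / Real.sin (π * t) : ℝ) : ℂ) *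
            ∫ u in (1 : ℝ)..(1 + t / (m : ℝ)), (u : ℂ) ^ (-s - 1)‖
        ≤ C * (‖s‖ + 1) ^ 2 / ((m : ℝ) * (2 * l + 1) ^ 2) := by
  refine ⟨112, by norm_num, fun s h0 h1 m hm l hl => ?_⟩
  have hm1 : (1 : ℝ) ≤ m := by exact_mod_cast hm
  have habs : |(m : ℝ)⁻¹| = (m : ℝ)⁻¹ := abs_of_nonneg (by positivity)
  have hε : |(m : ℝ)⁻¹| ≤ 1 := habs.trans_le (inv_le_one_of_one_le₀ hm1)
  obtain ⟨ip, hp⟩ := norm_integral_dirichlet_mul_integral_cpow_sub_le h0 h1 hε hl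
  obtain ⟨iq, hq⟩ := norm_integral_dirichlet_mul_integral_cpow_sub_le h0 h1
    (ε := -(m : ℝ)⁻¹) (by rwa [abs_neg]) hl
  rw [abs_neg] at hq
  rw [habs] at hp hq
  set f : ℝ → ℂ := fun t => ((sin ((2 * (l : ℝ) + 1) * π * t) / sin (π * t) : ℝ) : ℂ) *
    ∫ u in (1 : ℝ)..(1 + t / (m : ℝ)), (u : ℂ) ^ (-s - 1) with hf
  have ep : (fun t : ℝ => ((sin ((2 * (l : ℝ) + 1) * π * t) / sin (π * t) : ℝ) : ℂ) *
      ∫ u in (1 : ℝ)..(1 + (m : ℝ)⁻¹ * t), (u : ℂ) ^ (-s - 1)) = f := by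
    funext t
    rw [hf, inv_mul_eq_div]
  have eq : (fun t : ℝ => ((sin ((2 * (l : ℝ) + 1) * π * t) / sin (π * t) : ℝ) : ℂ) *
      ∫ u in (1 : ℝ)..(1 + -(m : ℝ)⁻¹ * t), (u : ℂ) ^ (-s - 1)) = fun t => f (-t) := by
    funext t
    simp only [hf, mul_neg, sin_neg, neg_div_neg_eq]
    rw [neg_mul, inv_mul_eq_div, neg_div]
  rw [ep] at ip hp
  rw [eq] at iq hq
  have iq' : IntervalIntegrable f volume (-(1 / 2)) 0 := by
    have := (IntervalIntegrable.iff_comp_neg (f := f) (a := 0) (b := -(1 / 2))).2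
      (by simpa using iq)
    exact this.symm
  rw [intervalIntegral.integral_comp_neg, neg_zero] at hq
  rw [← intervalIntegral.integral_add_adjacent_intervals iq' ip]
  have hsum := (norm_add_le _ _).trans (add_le_add hq hp)
  push_cast at hsum
  calc _ ≤ _ := by
        refine le_of_eq_of_le (congrArg _ ?_) hsum
        ring
    _ = _ := by field_simp; ring
end
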